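/- With H(b_i ⊗ b_j) = max(i, 2−j) − 1, the generating function of multi-grounded partitions in ²𝒫^≫_{c_0 c_2} having an even total number of parts satisfies: ∑_{π ∈ ²𝒫^≫_{c_0 c_2}, even number of parts} C(π) q^{|π|} = (c_0 c_2 / (c_0 c_2 q⁴; q⁴)_∞) · (1/2) · [ (−c_0 q³; q²)_∞ (−c_2 q^{−1}; q²)_∞ / (c_1 q; q²)_∞ + (c_0 q³; q²)_∞ (c_2 q^{−1}; q²)_∞ / (−c_1 q; q²)_∞ ], valid for complex q, c_0, c_1, c_2 with 0 < |q| < 1 and |c_0|, |c_1|, |c_2| ≤ 1. -/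

import Mathlib

open scoped BigOperators

/-- The infinite q-Pochhammer symbol `(a; q)_∞ = ∏_{k≥0} (1 - a qᵏ)`. -/
noncomputable def qPoch (a q : ℂ) : ℂ := ∏' k : ℕ, (1 - a * q ^ k)

/-- The energy function `H(b_i ⊗ b_j) = max(i, 2−j) − 1` for the level-2 perfect crystal
of `A_1^{(1)}`, with `i, j ∈ {0,1,2}`, valued in `ℤ`. -/
def H2 (i j : ℕ) : ℤ := max (i : ℤ) (2 - (j : ℤ)) - 1

/-- The step condition: writing `x = π_k` and `y = π_{k+1}` as pairs (part, colour), it requires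
`p_k − p_{k+1} − 2H(b_{a_{k+1}} ⊗ b_{a_k}) ∈ 2ℤ_{≥0}`. -/
def Step2 (x y : ℤ × ℕ) : Prop := ∃ t : ℕ, x.1 - y.1 - 2 * H2 y.2 x.2 = 2 * (t : ℤ)

/-- Multi-grounded partitions in `²𝒫^≫_{c_0 c_2}`: lists of (part, colour) pairs with colours
in `{0,1,2}`, all consecutive steps satisfying the condition `Step2`, whose last two parts are
`1` coloured `c_0` and `−1` coloured `c_2`, and such that the two parts preceding this tail are
not `1_{c_0}, (−1)_{c_2}`. -/
def MG02 (L : List (ℤ × ℕ)) : Prop :=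
  (∀ p ∈ L, p.2 ≤ 2) ∧ List.Chain' Step2 L ∧
    ∃ M, L = M ++ [((1 : ℤ), 0), ((-1 : ℤ), 2)] ∧
      ¬ ∃ M', M = M' ++ [((1 : ℤ), 0), ((-1 : ℤ), 2)]

/-- The generating function `∑_π C(π) q^{|π|}` over all lists satisfying a predicate `P`, where
`C(π) = c_0^A c_1^B c_2^D` records the numbers of parts of each colour, and `|π|` is the sum
of the parts. -/
noncomputable def genFun (P : List (ℤ × ℕ) → Prop) (q c0 c1 c2 : ℂ) : ℂ :=
  ∑' L : {L : List (ℤ × ℕ) // P L},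
    c0 ^ (L.1.countP fun p => p.2 == 0) * c1 ^ (L.1.countP fun p => p.2 == 1) *
      c2 ^ (L.1.countP fun p => p.2 == 2) * q ^ ((L.1.map Prod.fst).sum)


/-! ### Words alternating between two letters -/

/-- The word `a b a b ⋯ a b` of length `2 * m`, followed by one more `a` if `e` holds. -/
def alternatingTail {α : Type*} (a b : α) (e : Bool) : ℕ → List α
  | 0 => bif e then [a] else []
  | m + 1 => a :: b :: alternatingTail a b e m

/-- All words alternating between `a` and `b`, parametrized by whether there is an initial `b`,
whether there is a final `a`, and the number of blocks `a b` in between. -/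
def alternatingWord {α : Type*} (a b : α) (t : Bool × Bool × ℕ) : List α :=
  (bif t.1 then [b] else []) ++ alternatingTail a b t.2.1 t.2.2

theorem alternatingTail_injective {α : Type*} (a b : α) {e e' : Bool} {m m' : ℕ}
    (h : alternatingTail a b e m = alternatingTail a b e' m') : e = e' ∧ m = m' := by
  induction m generalizing m' with
  | zero => cases m' <;> cases e <;> cases e' <;> simp_all [alternatingTail]
  | succ m ih =>
    cases m' with
    | zero => cases e' <;> simp [alternatingTail] at h
    | succ m' => simpa using ih (by simpa [alternatingTail] using h)

theorem head?_alternatingTail {α : Type*} (a b : α) (e : Bool) (m : ℕ) :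
    ∀ x ∈ (alternatingTail a b e m).head?, x = a := by
  cases m <;> cases e <;> simp [alternatingTail]

theorem alternatingWord_injective {α : Type*} {a b : α} (hab : a ≠ b) :
    Function.Injective (alternatingWord a b) := by
  rintro ⟨e, d, m⟩ ⟨e', d', m'⟩ h
  have h1 := head?_alternatingTail a b d m
  have h2 := head?_alternatingTail a b d' m'
  cases e <;> cases e'
  · have := alternatingTail_injective a b (by simpa [alternatingWord] using h)
    simp [this]
  · simp only [alternatingWord, cond_true, cond_false, List.nil_append, List.cons_append] at h
    rw [h] at h1
    exact absurd (h1 b (by simp)) hab.symm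
  · simp only [alternatingWord, cond_true, cond_false, List.nil_append, List.cons_append] at h
    rw [← h] at h2
    exact absurd (h2 b (by simp)) hab.symm
  · have := alternatingTail_injective a b (by simpa [alternatingWord] using h)
    simp [this]

theorem mem_alternatingTail {α : Type*} {a b : α} {e : Bool} {m : ℕ} {x : α}
    (hx : x ∈ alternatingTail a b e m) : x = a ∨ x = b := by
  induction m with
  | zero => cases e <;> simp_all [alternatingTail]
  | succ m ih => simp only [alternatingTail, List.mem_cons] at hx; tauto

theorem mem_alternatingWord {α : Type*} {a b : α} {t : Bool × Bool × ℕ} {x : α}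
    (hx : x ∈ alternatingWord a b t) : x = a ∨ x = b := by
  obtain ⟨e, d, m⟩ := t
  simp only [alternatingWord, List.mem_append] at hx
  rcases hx with hx | hx
  · cases e <;> simp_all
  · exact mem_alternatingTail hx

theorem isChain_alternatingTail {α : Type*} {R : α → α → Prop} {a b : α} (hab : R a b)
    (hba : R b a) (e : Bool) (m : ℕ) : (alternatingTail a b e m).IsChain R := by
  induction m with
  | zero => cases e <;> simp [alternatingTail]
  | succ m ih =>
    refine List.IsChain.cons_cons hab (List.isChain_cons.2 ⟨fun y hy => ?_, ih⟩)
    rw [head?_alternatingTail a b e m y hy]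
    exact hba

theorem isChain_alternatingWord {α : Type*} {R : α → α → Prop} {a b : α} (hab : R a b)
    (hba : R b a) (t : Bool × Bool × ℕ) : (alternatingWord a b t).IsChain R := by
  obtain ⟨e, d, m⟩ := t
  cases e
  · simpa [alternatingWord] using isChain_alternatingTail hab hba d m
  · refine List.isChain_cons.2 ⟨fun y hy => ?_, isChain_alternatingTail hab hba d m⟩
    rw [head?_alternatingTail a b d m y hy]
    exact hba

theorem cons_alternatingWord {α : Type*} {a b x : α} (t : Bool × Bool × ℕ) (hx : x = a ∨ x = b)
    (h : ∀ y ∈ (alternatingWord a b t).head?, y ≠ x) :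
    ∃ t', x :: alternatingWord a b t = alternatingWord a b t' := by
  obtain ⟨e, d, m⟩ := t
  rcases hx with rfl | rfl
  · cases e
    · cases m
      · cases d
        · exact ⟨(false, true, 0), rfl⟩
        · exact absurd rfl (h x (by simp [alternatingWord, alternatingTail]))
      · exact absurd rfl (h x (by simp [alternatingWord, alternatingTail]))
    · exact ⟨(false, d, m + 1), rfl⟩
  · cases e
    · exact ⟨(true, d, m), rfl⟩
    · exact absurd rfl (h x (by simp [alternatingWord]))

/-! ### The weak order underlying the step condition -/

/-- The rank of a coloured integer: a step goes weakly down in rank. -/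
def rank2 (p : ℤ × ℕ) : ℤ := p.1 + p.2 - 2

theorem step2_iff (x y : ℤ × ℕ) : Step2 x y ↔
    (x.1 - y.1) % 2 = 0 ∧ 2 * (y.2 : ℤ) - 2 ≤ x.1 - y.1 ∧ 2 - 2 * (x.2 : ℤ) ≤ x.1 - y.1 := by
  unfold Step2 H2
  constructor
  · rintro ⟨t, ht⟩
    omega
  · rintro ⟨h1, h2, h3⟩
    exact ⟨((x.1 - y.1 - 2 * (max (y.2 : ℤ) (2 - (x.2 : ℤ)) - 1)) / 2).toNat, by omega⟩

theorem Step2.rank2_le {x y : ℤ × ℕ} (h : Step2 x y) : rank2 y ≤ rank2 x := by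
  rw [step2_iff] at h
  unfold rank2
  omega

theorem step2_of_rank2_lt {x y : ℤ × ℕ} (hx : x.2 ≤ 2) (hx' : x.1 % 2 = 1) (hy : y.2 ≤ 2)
    (hy' : y.1 % 2 = 1) (h : rank2 y < rank2 x) : Step2 x y := by
  obtain ⟨k, i⟩ := x
  obtain ⟨l, j⟩ := y
  rw [step2_iff]
  simp only [rank2] at *
  interval_cases i <;> interval_cases j <;> simp at * <;> omega

/-! ### Words of bounded rank -/

/-- Words satisfying the step condition, with odd parts and ranks in `[0, 2 * j)`. -/
def boundedWords (j : ℕ) : Set (List (ℤ × ℕ)) :=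
  {M | M.IsChain Step2 ∧ ∀ p ∈ M, p.2 ≤ 2 ∧ p.1 % 2 = 1 ∧ 0 ≤ rank2 p ∧ rank2 p < 2 * j}

/-- Words all of whose letters have rank `2 * j`. -/
def evenRankWords (j : ℕ) : Set (List (ℤ × ℕ)) :=
  Set.range fun n : ℕ => List.replicate n ((2 * j + 1 : ℤ), 1)

/-- Words all of whose letters have rank `2 * j + 1`. -/
def oddRankWords (j : ℕ) : Set (List (ℤ × ℕ)) :=
  Set.range (alternatingWord ((2 * j + 1 : ℤ), 2) ((2 * j + 3 : ℤ), 0))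

theorem mem_evenRankWords {j : ℕ} {l : List (ℤ × ℕ)} (hl : l ∈ evenRankWords j) {x : ℤ × ℕ}
    (hx : x ∈ l) : x = ((2 * j + 1 : ℤ), 1) := by
  obtain ⟨n, rfl⟩ := hl
  exact List.eq_of_mem_replicate hx

theorem mem_oddRankWords {j : ℕ} {l : List (ℤ × ℕ)} (hl : l ∈ oddRankWords j) {x : ℤ × ℕ}
    (hx : x ∈ l) : x = ((2 * j + 1 : ℤ), 2) ∨ x = ((2 * j + 3 : ℤ), 0) := by
  obtain ⟨t, rfl⟩ := hl
  exact mem_alternatingWord hx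

theorem boundedWords_zero : boundedWords 0 = {[]} := by
  ext M
  constructor
  · rintro ⟨-, h⟩
    cases M with
    | nil => rfl
    | cons p M =>
      have := h p (by simp)
      push_cast at this
      omega
  · rintro rfl
    simp [boundedWords]

theorem boundedWords_mono : Monotone boundedWords := by
  intro i j hij M hM
  refine ⟨hM.1, fun p hp => ?_⟩
  have := hM.2 p hp
  have : (i : ℤ) ≤ j := by exact_mod_cast hij
  omega

theorem append_mem_boundedWords {j : ℕ} {u v w : List (ℤ × ℕ)} (hu : u ∈ oddRankWords j)
    (hv : v ∈ evenRankWords j) (hw : w ∈ boundedWords j) :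
    u ++ (v ++ w) ∈ boundedWords (j + 1) := by
  have hu' : ∀ x ∈ u, x.2 ≤ 2 ∧ x.1 % 2 = 1 ∧ rank2 x = 2 * j + 1 := by
    intro x hx
    rcases mem_oddRankWords hu hx with rfl | rfl
    · simp [rank2]
    · simp [rank2]
      omega
  have hv' : ∀ x ∈ v, x.2 ≤ 2 ∧ x.1 % 2 = 1 ∧ rank2 x = 2 * j := by
    intro x hx
    rw [mem_evenRankWords hv hx]
    simp [rank2]
    omega
  have hw' := hw.2
  refine ⟨?_, ?_⟩
  · rw [List.isChain_append, List.isChain_append]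
    refine ⟨?_, ⟨?_, hw.1, ?_⟩, ?_⟩
    · obtain ⟨t, rfl⟩ := hu
      apply isChain_alternatingWord <;> rw [step2_iff] <;> simp
    · obtain ⟨n, rfl⟩ := hv
      exact List.isChain_replicate_of_rel n (by rw [step2_iff]; simp)
    · intro x hx y hy
      have h1 := hv' x (List.mem_of_mem_getLast? hx)
      have h2 := hw' y (List.mem_of_mem_head? hy)
      exact step2_of_rank2_lt h1.1 h1.2.1 h2.1 h2.2.1 (by omega)
    · intro x hx y hy
      have h1 := hu' x (List.mem_of_mem_getLast? hx)
      have h2 : y.2 ≤ 2 ∧ y.1 % 2 = 1 ∧ rank2 y < 2 * j + 1 := by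
        rcases List.mem_append.1 (List.mem_of_mem_head? hy) with h | h
        · have := hv' y h
          omega
        · have := hw' y h
          omega
      exact step2_of_rank2_lt h1.1 h1.2.1 h2.1 h2.2.1 (by omega)
  · intro x hx
    push_cast
    simp only [List.mem_append] at hx
    rcases hx with hx | hx | hx
    · have := hu' x hx
      omega
    · have := hv' x hx
      omega
    · have := hw' x hx
      omega

theorem exists_append_of_mem_boundedWords {j : ℕ} (M : List (ℤ × ℕ))
    (hM : M ∈ boundedWords (j + 1)) :
    ∃ u ∈ oddRankWords j, ∃ v ∈ evenRankWords j, ∃ w ∈ boundedWords j, u ++ (v ++ w) = M := by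
  induction M with
  | nil =>
    exact ⟨[], ⟨(false, false, 0), rfl⟩, [], ⟨0, rfl⟩, [], by simp [boundedWords], rfl⟩
  | cons x M ih =>
    obtain ⟨hc, hg⟩ := hM
    obtain ⟨hxM, hc'⟩ := List.isChain_cons.1 hc
    obtain ⟨u, hu, v, hv, w, hw, rfl⟩ := ih ⟨hc', fun p hp => hg p (List.mem_cons_of_mem _ hp)⟩
    have hx := hg x (by simp)
    obtain ⟨k, i⟩ := x
    have u_nil (h : rank2 (k, i) ≤ 2 * j) : u = [] := by
      cases u with
      | nil => rfl
      | cons y u =>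
        have h1 := (hxM y (by simp)).rank2_le
        rcases mem_oddRankWords hu List.mem_cons_self with rfl | rfl <;>
          simp [rank2] at * <;> omega
    rcases lt_trichotomy (rank2 (k, i)) (2 * j) with h | h | h
    · obtain rfl := u_nil h.le
      have v_nil : v = [] := by
        cases v with
        | nil => rfl
        | cons y v =>
          have h1 := (hxM y (by simp)).rank2_le
          rw [mem_evenRankWords hv List.mem_cons_self] at h1
          simp [rank2] at *
          omega
      subst v_nil
      refine ⟨[], hu, [], hv, (k, i) :: w, ⟨by simpa using hc, ?_⟩, rfl⟩
      intro p hp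
      rcases List.mem_cons.1 hp with rfl | hp
      · omega
      · exact hw.2 p hp
    · obtain rfl := u_nil h.le
      have : (k, i) = ((2 * j + 1 : ℤ), 1) := by
        simp only [rank2, Prod.mk.injEq] at *
        omega
      obtain ⟨n, rfl⟩ := hv
      exact ⟨[], hu, _, ⟨n + 1, rfl⟩, w, hw, by simp [this, List.replicate_succ]⟩
    · have hki : (k, i) = ((2 * j + 1 : ℤ), 2) ∨ (k, i) = ((2 * j + 3 : ℤ), 0) := by
        simp only [rank2, Prod.mk.injEq] at *
        push_cast at hx
        omega
      obtain ⟨t, rfl⟩ := hu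
      obtain ⟨t', ht'⟩ := cons_alternatingWord t hki (by
        rintro y hy rfl
        have h1 := hxM (k, i) (by
          rw [List.head?_append, Option.mem_def.1 hy]
          rfl)
        rw [step2_iff] at h1
        simp only [Prod.mk.injEq] at hki
        omega)
      exact ⟨_, ⟨t', rfl⟩, v, hv, w, hw, by rw [← ht']; rfl⟩

theorem boundedWords_succ (j : ℕ) : boundedWords (j + 1) =
    Set.image2 (· ++ ·) (oddRankWords j)
      (Set.image2 (· ++ ·) (evenRankWords j) (boundedWords j)) := by
  ext M
  constructor
  · intro hM
    obtain ⟨u, hu, v, hv, w, hw, h⟩ := exists_append_of_mem_boundedWords M hM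
    exact ⟨u, hu, _, ⟨v, hv, w, hw, rfl⟩, h⟩
  · rintro ⟨u, hu, _, ⟨v, hv, w, hw, rfl⟩, rfl⟩
    exact append_mem_boundedWords hu hv hw

/-! ### Decomposition of multi-grounded partitions -/

/-- The possible final parts of rank `-1` of a multi-grounded partition. -/
def groundTails : Set (List (ℤ × ℕ)) := {[(1, 0), (-1, 2)], [(-1, 2), (1, 0), (-1, 2)]}

theorem mem_boundedWords_of_isChain_append {x : ℤ × ℕ} (hx : x.1 % 2 = 1) (hx' : 0 ≤ rank2 x)
    (M : List (ℤ × ℕ)) (hM : ∀ p ∈ M, p.2 ≤ 2) (hc : (M ++ [x]).IsChain Step2) :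
    ∀ p ∈ M, p.2 ≤ 2 ∧ p.1 % 2 = 1 ∧ 0 ≤ rank2 p := by
  induction M with
  | nil => simp
  | cons y M ih =>
    rw [List.cons_append, List.isChain_cons] at hc
    have ih' := ih (fun p hp => hM p (List.mem_cons_of_mem _ hp)) hc.2
    intro p hp
    rcases List.mem_cons.1 hp with rfl | hp
    · refine ⟨hM p hp, ?_⟩
      obtain ⟨z, hz, hz1, hz2⟩ : ∃ z, Step2 p z ∧ z.1 % 2 = 1 ∧ 0 ≤ rank2 z := by
        cases M with
        | nil => exact ⟨x, hc.1 x (by simp), hx, hx'⟩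
        | cons z M => exact ⟨z, hc.1 z (by simp), (ih' z (by simp)).2⟩
      have h1 := hz.rank2_le
      rw [step2_iff] at hz
      omega
    · exact ih' p hp

theorem exists_mem_boundedWords {M : List (ℤ × ℕ)} (hM : M.IsChain Step2)
    (h : ∀ p ∈ M, p.2 ≤ 2 ∧ p.1 % 2 = 1 ∧ 0 ≤ rank2 p) : ∃ j, M ∈ boundedWords j := by
  induction M with
  | nil => exact ⟨0, by simp [boundedWords]⟩
  | cons x M ih =>
    obtain ⟨j, hj⟩ := ih (List.isChain_cons.1 hM).2 fun p hp => h p (List.mem_cons_of_mem _ hp)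
    refine ⟨max j ((rank2 x).toNat + 1), hM, fun p hp => ?_⟩
    rcases List.mem_cons.1 hp with rfl | hp'
    · have := h p hp
      push_cast
      omega
    · have := hj.2 p hp'
      push_cast
      omega

theorem MG02.mem_image2 {L : List (ℤ × ℕ)} (hL : MG02 L) :
    L ∈ Set.image2 (· ++ ·) (⋃ j, boundedWords j) groundTails := by
  obtain ⟨hcol, hc, M, rfl, hM⟩ := hL
  replace hc : (M ++ [((1 : ℤ), 0), ((-1 : ℤ), 2)]).IsChain Step2 := hc
  have hcM := (List.isChain_append.1 hc).1
  rcases List.eq_nil_or_concat' M with rfl | ⟨N, x, rfl⟩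
  · exact ⟨[], Set.mem_iUnion.2 ⟨0, by simp [boundedWords]⟩, _, Or.inl rfl, rfl⟩
  · have hx : Step2 x (1, 0) := by
      have := (List.isChain_append.1 hc).2.2
      exact this x (by simp) _ (by simp)
    have hx2 : x.2 ≤ 2 := hcol x (by simp)
    by_cases hxa : x = (-1, 2)
    · subst hxa
      refine ⟨N, Set.mem_iUnion.2 ?_, _, Or.inr rfl, by simp⟩
      refine exists_mem_boundedWords (List.isChain_append.1 hcM).1 ?_
      rcases List.eq_nil_or_concat' N with rfl | ⟨K, y, rfl⟩
      · simp
      · have hy : Step2 y (-1, 2) := by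
          have := (List.isChain_append.1 hcM).2.2
          exact this y (by simp) _ (by simp)
        have hy2 : y.2 ≤ 2 := hcol y (by simp)
        have hyb : y ≠ (1, 0) := by
          rintro rfl
          exact hM ⟨K, by simp⟩
        obtain ⟨k, i⟩ := y
        have : k % 2 = 1 ∧ 0 ≤ rank2 (k, i) := by
          rw [step2_iff] at hy
          simp [rank2] at *
          omega
        have h3 := mem_boundedWords_of_isChain_append this.1 this.2 K
          (fun p hp => hcol p (by simp [hp])) (List.isChain_append.1 hcM).1
        intro p hp
        rcases List.mem_append.1 hp with hp | hp
        · exact h3 p hp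
        · obtain rfl := List.mem_singleton.1 hp
          exact ⟨hy2, this⟩
    · refine ⟨N ++ [x], Set.mem_iUnion.2 ?_, _, Or.inl rfl, rfl⟩
      refine exists_mem_boundedWords hcM ?_
      obtain ⟨k, i⟩ := x
      have : k % 2 = 1 ∧ 0 ≤ rank2 (k, i) := by
        rw [step2_iff] at hx
        simp [rank2] at *
        omega
      have h3 := mem_boundedWords_of_isChain_append this.1 this.2 N
        (fun p hp => hcol p (by simp [hp])) hcM
      intro p hp
      rcases List.mem_append.1 hp with hp | hp
      · exact h3 p hp
      · obtain rfl := List.mem_singleton.1 hp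
        exact ⟨hx2, this⟩

theorem mem_groundTails {t : List (ℤ × ℕ)} (ht : t ∈ groundTails) {x : ℤ × ℕ} (hx : x ∈ t) :
    x.2 ≤ 2 ∧ x.1 % 2 = 1 ∧ rank2 x = -1 := by
  have : x = (1, 0) ∨ x = (-1, 2) := by
    rcases ht with rfl | rfl <;> simp at hx <;> tauto
  rcases this with rfl | rfl <;> simp [rank2]

theorem mg02_append {M t : List (ℤ × ℕ)} {j : ℕ} (hM : M ∈ boundedWords j)
    (ht : t ∈ groundTails) : MG02 (M ++ t) := by
  refine ⟨?_, ?_, ?_⟩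
  · intro p hp
    rcases List.mem_append.1 hp with hp | hp
    · exact (hM.2 p hp).1
    · exact (mem_groundTails ht hp).1
  · refine List.isChain_append.2 ⟨hM.1, ?_, ?_⟩
    · rcases ht with rfl | rfl <;> simp [step2_iff]
    · intro x hx y hy
      have h1 := hM.2 x (List.mem_of_mem_getLast? hx)
      have h2 := mem_groundTails ht (List.mem_of_mem_head? hy)
      exact step2_of_rank2_lt h1.1 h1.2.1 h2.1 h2.2.1 (by omega)
  · rcases ht with rfl | rfl
    · refine ⟨M, rfl, ?_⟩
      rintro ⟨M', rfl⟩
      have := hM.2 (-1, 2) (by simp)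
      simp [rank2] at this
    · refine ⟨M ++ [(-1, 2)], by simp, ?_⟩
      rintro ⟨M', h⟩
      have h' : M = M' ++ [(1, 0)] := by
        have : M ++ [((-1 : ℤ), 2)] = (M' ++ [((1 : ℤ), 0)]) ++ [((-1 : ℤ), 2)] := by simpa using h
        exact List.append_cancel_right this
      have := hM.2 (1, 0) (by simp [h'])
      simp [rank2] at this

theorem setOf_mg02 : {L | MG02 L} = Set.image2 (· ++ ·) (⋃ j, boundedWords j) groundTails := by
  ext L
  constructor
  · exact MG02.mem_image2
  · rintro ⟨M, hM, t, ht, rfl⟩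
    obtain ⟨j, hj⟩ := Set.mem_iUnion.1 hM
    exact mg02_append hj ht

/-! ### Summing multiplicative weights over sets of words -/

/-- The weight of a word: the product of the weights of its letters. -/
def wordWeight {α : Type*} (w : α → ℂ) (l : List α) : ℂ := (l.map w).prod

theorem wordWeight_append {α : Type*} (w : α → ℂ) (l l' : List α) :
    wordWeight w (l ++ l') = wordWeight w l * wordWeight w l' := by
  simp [wordWeight]

theorem append_inj_of_forall_mem {α : Type*} {P : α → Prop} {u u' v v' : List α}
    (hu : ∀ x ∈ u, P x) (hu' : ∀ x ∈ u', P x) (hv : ∀ x ∈ v, ¬P x) (hv' : ∀ x ∈ v', ¬P x)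
    (h : u ++ v = u' ++ v') : u = u' ∧ v = v' := by
  classical
  have h1 : ∀ {a b : List α}, (∀ x ∈ a, P x) → (∀ x ∈ b, ¬P x) →
      (a ++ b).filter (fun x => P x) = a := by
    intro a b ha hb
    rw [List.filter_append, List.filter_eq_self.2 (by simpa using ha),
      List.filter_eq_nil_iff.2 (by simpa using hb), List.append_nil]
  have h2 : u = u' := by rw [← h1 hu hv, h, h1 hu' hv']
  subst h2
  exact ⟨rfl, List.append_cancel_left h⟩

theorem hasSum_mul_prod {ι κ : Type*} {f : ι → ℂ} {g : κ → ℂ} {s t : ℂ} (hf : HasSum f s)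
    (hg : HasSum g t) : HasSum (fun p : ι × κ => f p.1 * g p.2) (s * t) :=
  HasSum.mul hf hg (summable_mul_of_summable_norm hf.summable.norm hg.summable.norm)

theorem hasSum_image2_append {α : Type*} {w : α → ℂ} {S T : Set (List α)} (P : α → Prop)
    (hS : ∀ l ∈ S, ∀ x ∈ l, P x) (hT : ∀ l ∈ T, ∀ x ∈ l, ¬P x) {s t : ℂ}
    (hs : HasSum (fun l : S => wordWeight w l) s) (ht : HasSum (fun l : T => wordWeight w l) t) :
    HasSum (fun l : Set.image2 (· ++ ·) S T => wordWeight w l) (s * t) := by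
  have key := hasSum_mul_prod hs ht
  let e : S × T → Set.image2 (· ++ ·) S T :=
    fun p => ⟨p.1.1 ++ p.2.1, p.1.1, p.1.2, p.2.1, p.2.2, rfl⟩
  have he : Function.Bijective e := by
    constructor
    · rintro ⟨⟨u, hu⟩, v, hv⟩ ⟨⟨u', hu'⟩, v', hv'⟩ h
      have := append_inj_of_forall_mem (hS u hu) (hS u' hu') (hT v hv) (hT v' hv')
        (Subtype.ext_iff.1 h)
      simp [this]
    · rintro ⟨_, u, hu, v, hv, rfl⟩
      exact ⟨⟨⟨u, hu⟩, v, hv⟩, rfl⟩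
  rw [← (Equiv.ofBijective e he).hasSum_iff]
  convert key using 2 with p
  exact wordWeight_append w _ _

theorem wordWeight_alternatingTail {α : Type*} (w : α → ℂ) (a b : α) (e : Bool) (m : ℕ) :
    wordWeight w (alternatingTail a b e m) = (bif e then w a else 1) * (w a * w b) ^ m := by
  induction m with
  | zero => cases e <;> simp [alternatingTail, wordWeight]
  | succ m ih =>
    simp only [wordWeight, alternatingTail, List.map_cons, List.prod_cons] at ih ⊢
    rw [ih]
    ring

theorem hasSum_alternatingWord {α : Type*} (w : α → ℂ) {a b : α} (hab : a ≠ b)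
    (h : ‖w a * w b‖ < 1) :
    HasSum (fun l : Set.range (alternatingWord a b) => wordWeight w l)
      ((1 + w b) * ((1 + w a) * (1 - w a * w b)⁻¹)) := by
  have hbool (z : ℂ) : HasSum (fun e : Bool => bif e then z else 1) (1 + z) := by
    convert hasSum_fintype (fun e : Bool => bif e then z else 1) using 1
    simp [add_comm]
  have h1 := hasSum_geometric_of_norm_lt_one h
  have h2 := hasSum_mul_prod (hbool (w a)) h1
  have h3 := hasSum_mul_prod (hbool (w b)) h2
  rw [← (Equiv.ofInjective _ (alternatingWord_injective hab)).hasSum_iff]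
  convert h3 using 2 with t
  obtain ⟨e, d, m⟩ := t
  simp only [Function.comp, Equiv.ofInjective_apply, alternatingWord, wordWeight_append,
    wordWeight_alternatingTail]
  cases e <;> simp [wordWeight]

theorem hasSum_replicate {α : Type*} (w : α → ℂ) (a : α) (h : ‖w a‖ < 1) :
    HasSum (fun l : Set.range fun n : ℕ => List.replicate n a => wordWeight w l)
      (1 - w a)⁻¹ := by
  have hinj : Function.Injective fun n : ℕ => List.replicate n a := fun m n hmn => by
    simpa using congrArg List.length hmn
  rw [← (Equiv.ofInjective _ hinj).hasSum_iff]
  have hfun : (fun l : Set.range fun n : ℕ => List.replicate n a => wordWeight w l) ∘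
      Equiv.ofInjective _ hinj = fun n => w a ^ n := by
    funext n
    simp [wordWeight]
  rw [hfun]
  exact hasSum_geometric_of_norm_lt_one h

/-! ### Words with the weights of coloured partitions -/

/-- The weight `c q ^ p` of a coloured integer. -/
noncomputable def letterWeight (q c0 c1 c2 : ℂ) (p : ℤ × ℕ) : ℂ :=
  (if p.2 = 0 then c0 else if p.2 = 1 then c1 else c2) * q ^ p.1

/-- The sum of the weights of the words of ranks `2 * j` and `2 * j + 1`. -/
noncomputable def levelFactor (q c0 c1 c2 : ℂ) (j : ℕ) : ℂ :=
  (1 - -c0 * q ^ 3 * (q ^ 2) ^ j) * (1 - -c2 * q * (q ^ 2) ^ j) /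
    ((1 - c1 * q * (q ^ 2) ^ j) * (1 - c0 * c2 * q ^ 4 * (q ^ 4) ^ j))

section Weights

variable {q c0 c1 c2 : ℂ}

theorem norm_mul_pow_lt_one {q c : ℂ} (hq : ‖q‖ < 1) (hc : ‖c‖ ≤ 1) {n : ℕ} (hn : n ≠ 0) :
    ‖c * q ^ n‖ < 1 := by
  rw [norm_mul, norm_pow]
  exact mul_lt_one_of_nonneg_of_lt_one_right hc (by positivity) (pow_lt_one₀ (norm_nonneg q) hq hn)

theorem hasSum_boundedWords (hq0 : 0 < ‖q‖) (hq : ‖q‖ < 1) (h0 : ‖c0‖ ≤ 1) (h1 : ‖c1‖ ≤ 1)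
    (h2 : ‖c2‖ ≤ 1) (N : ℕ) :
    HasSum (fun l : boundedWords N => wordWeight (letterWeight q c0 c1 c2) l)
      (∏ j ∈ Finset.range N, levelFactor q c0 c1 c2 j) := by
  have hq' : q ≠ 0 := norm_pos_iff.1 hq0
  induction N with
  | zero =>
    rw [boundedWords_zero]
    convert hasSum_unique (fun l : ({[]} : Set (List (ℤ × ℕ))) =>
      wordWeight (letterWeight q c0 c1 c2) l) using 1
    change ∏ j ∈ Finset.range 0, levelFactor q c0 c1 c2 j = wordWeight _ []
    simp [wordWeight]
  | succ j ih =>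
    rw [boundedWords_succ, Finset.prod_range_succ]
    have wc : letterWeight q c0 c1 c2 (2 * j + 1, 1) = c1 * q ^ (2 * j + 1) := by
      simp only [letterWeight, one_ne_zero, if_false, if_true]
      norm_cast
    have wa : letterWeight q c0 c1 c2 (2 * j + 1, 2) = c2 * q ^ (2 * j + 1) := by
      simp only [letterWeight, OfNat.ofNat_ne_zero, OfNat.ofNat_ne_one, if_false]
      norm_cast
    have wb : letterWeight q c0 c1 c2 (2 * j + 3, 0) = c0 * q ^ (2 * j + 3) := by
      simp only [letterWeight, if_true]
      norm_cast
    have hA := hasSum_replicate (letterWeight q c0 c1 c2) (2 * j + 1, 1)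
      (by rw [wc]; exact norm_mul_pow_lt_one hq h1 (by omega))
    have hB := hasSum_alternatingWord (letterWeight q c0 c1 c2) (a := (2 * j + 1, 2))
      (b := (2 * j + 3, 0)) (by simp) (by
        rw [wa, wb, norm_mul]
        exact mul_lt_one_of_nonneg_of_lt_one_left (norm_nonneg _)
          (norm_mul_pow_lt_one hq h2 (by omega)) (norm_mul_pow_lt_one hq h0 (by omega)).le)
    have hAw := hasSum_image2_append (fun x => rank2 x = 2 * j)
      (fun l hl x hx => by rw [mem_evenRankWords hl hx]; simp [rank2]; ring)
      (fun l hl x hx => ((hl.2 x hx).2.2.2).ne) hA ih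
    have hBAw := hasSum_image2_append (fun x => rank2 x = 2 * j + 1)
      (fun l hl x hx => by
        rcases mem_oddRankWords hl hx with rfl | rfl
        · simp [rank2]
        · simp [rank2]
          ring)
      (fun l hl x hx => by
        obtain ⟨u, hu, v, hv, rfl⟩ := hl
        rcases List.mem_append.1 hx with hx | hx
        · rw [mem_evenRankWords hu hx]
          simp [rank2]
          omega
        · have := hv.2 x hx
          omega) hB hAw
    have hval : (1 + c0 * q ^ (2 * j + 3)) * ((1 + c2 * q ^ (2 * j + 1)) *
        (1 - c2 * q ^ (2 * j + 1) * (c0 * q ^ (2 * j + 3)))⁻¹) *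
        ((1 - c1 * q ^ (2 * j + 1))⁻¹ * ∏ i ∈ Finset.range j, levelFactor q c0 c1 c2 i) =
        (∏ i ∈ Finset.range j, levelFactor q c0 c1 c2 i) * levelFactor q c0 c1 c2 j := by
      rw [levelFactor, div_eq_mul_inv, mul_inv]
      ring_nf
    rw [wa, wb, wc, hval] at hBAw
    exact hBAw

theorem tendsto_qPoch {a r : ℂ} (hr : ‖r‖ < 1) :
    Filter.Tendsto (fun N => ∏ j ∈ Finset.range N, (1 - a * r ^ j)) Filter.atTop
      (nhds (qPoch a r)) := by
  have : Multipliable fun k : ℕ => 1 - a * r ^ k := by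
    simp only [sub_eq_add_neg]
    refine multipliable_one_add_of_summable ?_
    simpa using (summable_geometric_of_lt_one (norm_nonneg r) hr).mul_left ‖a‖
  exact this.tendsto_prod_tprod_nat

theorem qPoch_ne_zero {a r : ℂ} (hr : ‖r‖ < 1) (ha : ‖a‖ < 1) : qPoch a r ≠ 0 := by
  unfold qPoch
  simp only [sub_eq_add_neg]
  refine tprod_one_add_ne_zero_of_summable (fun k => ?_) ?_
  · rw [← sub_eq_add_neg, sub_ne_zero]
    intro h
    have h1 : ‖a * r ^ k‖ < 1 := by
      rw [norm_mul, norm_pow]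
      exact mul_lt_one_of_nonneg_of_lt_one_left (norm_nonneg _) ha
        (pow_le_one₀ (norm_nonneg r) hr.le)
    rw [← h, norm_one] at h1
    exact lt_irrefl _ h1
  · simpa using (summable_geometric_of_lt_one (norm_nonneg r) hr).mul_left ‖a‖

theorem qPoch_eq_mul {a r : ℂ} (hr : ‖r‖ < 1) : qPoch a r = (1 - a) * qPoch (a * r) r := by
  refine tendsto_nhds_unique ((tendsto_qPoch hr).comp (Filter.tendsto_add_atTop_nat 1)) ?_
  convert (tendsto_qPoch (a := a * r) hr).const_mul (1 - a) using 2 with N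
  simp only [Function.comp, Finset.prod_range_succ', pow_zero, mul_one]
  rw [mul_comm]
  congr 1
  refine Finset.prod_congr rfl fun j _ => ?_
  ring

theorem tendsto_prod_levelFactor (hq : ‖q‖ < 1) (h0 : ‖c0‖ ≤ 1) (h1 : ‖c1‖ ≤ 1)
    (h2 : ‖c2‖ ≤ 1) :
    Filter.Tendsto (fun N => ∏ j ∈ Finset.range N, levelFactor q c0 c1 c2 j) Filter.atTop
      (nhds (qPoch (-c0 * q ^ 3) (q ^ 2) * qPoch (-c2 * q) (q ^ 2) /
        (qPoch (c1 * q) (q ^ 2) * qPoch (c0 * c2 * q ^ 4) (q ^ 4)))) := by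
  have hpow {n : ℕ} (hn : n ≠ 0) : ‖q ^ n‖ < 1 := by
    rw [norm_pow]
    exact pow_lt_one₀ (norm_nonneg q) hq hn
  simp only [levelFactor, Finset.prod_div_distrib, Finset.prod_mul_distrib]
  have h02 : ‖c0 * c2‖ ≤ 1 := by
    rw [norm_mul]
    exact mul_le_one₀ h0 (norm_nonneg _) h2
  refine Filter.Tendsto.div ?_ ?_ (mul_ne_zero ?_ ?_)
  · exact (tendsto_qPoch (hpow two_ne_zero)).mul (tendsto_qPoch (hpow two_ne_zero))
  · exact (tendsto_qPoch (hpow two_ne_zero)).mul (tendsto_qPoch (hpow four_ne_zero))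
  · exact qPoch_ne_zero (hpow two_ne_zero)
      (by simpa using norm_mul_pow_lt_one hq h1 one_ne_zero)
  · exact qPoch_ne_zero (hpow four_ne_zero) (norm_mul_pow_lt_one hq h02 four_ne_zero)

theorem ofReal_norm_wordWeight (l : List (ℤ × ℕ)) :
    ((‖wordWeight (letterWeight q c0 c1 c2) l‖ : ℝ) : ℂ) =
      wordWeight (letterWeight ‖q‖ ‖c0‖ ‖c1‖ ‖c2‖) l := by
  induction l with
  | nil => simp [wordWeight]
  | cons p l ih =>
    simp only [wordWeight, List.map_cons, List.prod_cons, norm_mul, Complex.ofReal_mul] at ih ⊢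
    rw [ih]
    congr 1
    simp only [letterWeight, norm_mul, norm_zpow]
    split_ifs <;> simp

theorem summable_iUnion_boundedWords (hq0 : 0 < ‖q‖) (hq : ‖q‖ < 1) (h0 : ‖c0‖ ≤ 1)
    (h1 : ‖c1‖ ≤ 1) (h2 : ‖c2‖ ≤ 1) :
    Summable ((⋃ j, boundedWords j).indicator
      fun l => ‖wordWeight (letterWeight q c0 c1 c2) l‖) := by
  set f : List (ℤ × ℕ) → ℝ := fun l => ‖wordWeight (letterWeight q c0 c1 c2) l‖
  obtain ⟨C, hC⟩ := (tendsto_prod_levelFactor (q := ‖q‖) (c0 := ‖c0‖) (c1 := ‖c1‖) (c2 := ‖c2‖)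
    (by simpa) (by simpa) (by simpa) (by simpa)).norm.bddAbove_range
  have hN (N : ℕ) : HasSum ((boundedWords N).indicator f)
      ‖∏ j ∈ Finset.range N, levelFactor ‖q‖ ‖c0‖ ‖c1‖ ‖c2‖ j‖ := by
    have h := hasSum_boundedWords (q := ‖q‖) (c0 := ‖c0‖) (c1 := ‖c1‖) (c2 := ‖c2‖)
      (by simpa using norm_pos_iff.1 hq0) (by simpa) (by simpa) (by simpa) (by simpa) N
    simp only [← ofReal_norm_wordWeight] at h
    have hs := Complex.summable_ofReal.1 h.summable
    rw [← hasSum_subtype_iff_indicator]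
    suffices ‖∏ j ∈ Finset.range N, levelFactor ‖q‖ ‖c0‖ ‖c1‖ ‖c2‖ j‖ =
        ∑' l : boundedWords N, f l by
      rw [this]
      exact hs.hasSum
    rw [← h.tsum_eq, ← Complex.ofReal_tsum, Complex.norm_real, Real.norm_of_nonneg]
    exact tsum_nonneg fun _ => norm_nonneg _
  refine summable_of_sum_le (c := C)
    (fun l => Set.indicator_nonneg (fun _ _ => norm_nonneg _) l) fun s => ?_
  obtain ⟨N, hsN⟩ : ∃ N, ∀ l ∈ s, l ∈ ⋃ j, boundedWords j → l ∈ boundedWords N := by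
    classical
    choose! g hg using fun (l : List (ℤ × ℕ)) (hl : l ∈ ⋃ j, boundedWords j) => Set.mem_iUnion.1 hl
    exact ⟨s.sup g, fun l hl hl' => boundedWords_mono (Finset.le_sup hl) (hg l hl')⟩
  calc ∑ l ∈ s, (⋃ j, boundedWords j).indicator f l
      ≤ ∑ l ∈ s, (boundedWords N).indicator f l := by
        refine Finset.sum_le_sum fun l hl => ?_
        by_cases hl' : l ∈ ⋃ j, boundedWords j
        · rw [Set.indicator_of_mem hl', Set.indicator_of_mem (hsN l hl hl')]
        · rw [Set.indicator_of_notMem hl']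
          exact Set.indicator_nonneg (fun _ _ => norm_nonneg _) l
    _ ≤ _ := sum_le_hasSum s (fun l _ => Set.indicator_nonneg (fun _ _ => norm_nonneg _) l) (hN N)
    _ ≤ C := hC ⟨N, rfl⟩

theorem hasSum_iUnion_boundedWords (hq0 : 0 < ‖q‖) (hq : ‖q‖ < 1) (h0 : ‖c0‖ ≤ 1)
    (h1 : ‖c1‖ ≤ 1) (h2 : ‖c2‖ ≤ 1) :
    HasSum (fun l : ⋃ j, boundedWords j => wordWeight (letterWeight q c0 c1 c2) l)
      (qPoch (-c0 * q ^ 3) (q ^ 2) * qPoch (-c2 * q) (q ^ 2) /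
        (qPoch (c1 * q) (q ^ 2) * qPoch (c0 * c2 * q ^ 4) (q ^ 4))) := by
  set f : List (ℤ × ℕ) → ℂ := wordWeight (letterWeight q c0 c1 c2) with hf
  have hs := summable_iUnion_boundedWords hq0 hq h0 h1 h2
  have hs' : Summable ((⋃ j, boundedWords j).indicator f) := by
    refine Summable.of_norm (hs.congr fun l => ?_)
    rw [norm_indicator_eq_indicator_norm]
  have hlim : Filter.Tendsto (fun N => ∑' l, (boundedWords N).indicator f l) Filter.atTop
      (nhds (∑' l, (⋃ j, boundedWords j).indicator f l)) := by
    refine tendsto_tsum_of_dominated_convergence hs (fun l => ?_) (.of_forall fun N l => ?_)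
    · exact (boundedWords_mono.tendsto_indicator _ f l).mono_right (pure_le_nhds _)
    · rw [norm_indicator_eq_indicator_norm]
      exact Set.indicator_le_indicator_of_subset (Set.subset_iUnion _ N)
        (fun _ => norm_nonneg _) l
  have hN (N : ℕ) : ∑' l, (boundedWords N).indicator f l =
      ∏ j ∈ Finset.range N, levelFactor q c0 c1 c2 j := by
    rw [← tsum_subtype]
    exact (hasSum_boundedWords hq0 hq h0 h1 h2 N).tsum_eq
  simp only [hN] at hlim
  rw [← tendsto_nhds_unique hlim (tendsto_prod_levelFactor hq h0 h1 h2)]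
  exact hasSum_subtype_iff_indicator.2 hs'.hasSum

theorem hasSum_groundTails (hq0 : 0 < ‖q‖) :
    HasSum (fun l : groundTails => wordWeight (letterWeight q c0 c1 c2) l)
      (c0 * c2 * (1 - -c2 * q⁻¹)) := by
  have hq' : q ≠ 0 := norm_pos_iff.1 hq0
  have h := Finset.hasSum ({[(1, 0), (-1, 2)], [(-1, 2), (1, 0), (-1, 2)]} :
    Finset (List (ℤ × ℕ))) (wordWeight (letterWeight q c0 c1 c2))
  have hset : groundTails = ↑({[(1, 0), (-1, 2)], [(-1, 2), (1, 0), (-1, 2)]} :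
    Finset (List (ℤ × ℕ))) := by simp [groundTails]
  rw [hset]
  rw [Finset.sum_pair (by simp)] at h
  have hval : wordWeight (letterWeight q c0 c1 c2) [(1, 0), (-1, 2)] +
      wordWeight (letterWeight q c0 c1 c2) [(-1, 2), (1, 0), (-1, 2)] =
      c0 * c2 * (1 - -c2 * q⁻¹) := by
    simp [wordWeight, letterWeight]
    field_simp
  rw [hval] at h
  exact h

theorem hasSum_mg02 (hq0 : 0 < ‖q‖) (hq : ‖q‖ < 1) (h0 : ‖c0‖ ≤ 1) (h1 : ‖c1‖ ≤ 1)
    (h2 : ‖c2‖ ≤ 1) :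
    HasSum ({L | MG02 L}.indicator (wordWeight (letterWeight q c0 c1 c2)))
      (c0 * c2 / qPoch (c0 * c2 * q ^ 4) (q ^ 4) *
        (qPoch (-c0 * q ^ 3) (q ^ 2) * qPoch (-c2 * q⁻¹) (q ^ 2) / qPoch (c1 * q) (q ^ 2))) := by
  have hq' : q ≠ 0 := norm_pos_iff.1 hq0
  rw [← hasSum_subtype_iff_indicator, setOf_mg02]
  have key := hasSum_image2_append (fun x => 0 ≤ rank2 x)
    (fun l hl x hx => by
      obtain ⟨j, hj⟩ := Set.mem_iUnion.1 hl
      exact (hj.2 x hx).2.2.1)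
    (fun l hl x hx => by
      rw [(mem_groundTails hl hx).2.2]
      norm_num)
    (hasSum_iUnion_boundedWords hq0 hq h0 h1 h2) (hasSum_groundTails hq0)
  have hr : ‖q ^ 2‖ < 1 := by
    rw [norm_pow]
    exact pow_lt_one₀ (norm_nonneg q) hq two_ne_zero
  have hval : c0 * c2 / qPoch (c0 * c2 * q ^ 4) (q ^ 4) *
      (qPoch (-c0 * q ^ 3) (q ^ 2) * qPoch (-c2 * q⁻¹) (q ^ 2) / qPoch (c1 * q) (q ^ 2)) =
      qPoch (-c0 * q ^ 3) (q ^ 2) * qPoch (-c2 * q) (q ^ 2) /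
        (qPoch (c1 * q) (q ^ 2) * qPoch (c0 * c2 * q ^ 4) (q ^ 4)) *
        (c0 * c2 * (1 - -c2 * q⁻¹)) := by
    rw [qPoch_eq_mul (a := -c2 * q⁻¹) hr, show -c2 * q⁻¹ * q ^ 2 = -c2 * q by field_simp]
    simp only [div_eq_mul_inv, mul_inv]
    ring
  rw [hval]
  exact key

theorem wordWeight_letterWeight_eq (hq' : q ≠ 0) {l : List (ℤ × ℕ)} (hl : ∀ p ∈ l, p.2 ≤ 2) :
    wordWeight (letterWeight q c0 c1 c2) l =
      c0 ^ (l.countP fun p => p.2 == 0) * c1 ^ (l.countP fun p => p.2 == 1) *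
        c2 ^ (l.countP fun p => p.2 == 2) * q ^ ((l.map Prod.fst).sum) := by
  induction l with
  | nil => simp [wordWeight]
  | cons p l ih =>
    have ih := ih fun p hp => hl p (List.mem_cons_of_mem _ hp)
    have hp := hl p List.mem_cons_self
    obtain ⟨k, i⟩ := p
    simp only [wordWeight, List.map_cons, List.prod_cons, List.sum_cons, List.countP_cons] at ih ⊢
    rw [ih, zpow_add₀ hq']
    simp only at hp
    interval_cases i <;> simp [letterWeight, pow_succ] <;> ring

theorem wordWeight_letterWeight_neg (l : List (ℤ × ℕ)) :
    wordWeight (letterWeight q (-c0) (-c1) (-c2)) l =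
      (-1) ^ l.length * wordWeight (letterWeight q c0 c1 c2) l := by
  induction l with
  | nil => simp [wordWeight]
  | cons p l ih =>
    have : letterWeight q (-c0) (-c1) (-c2) p = -letterWeight q c0 c1 c2 p := by
      unfold letterWeight
      split_ifs <;> ring
    simp only [wordWeight, List.map_cons, List.prod_cons, List.length_cons] at ih ⊢
    rw [ih, this]
    ring

theorem hasSum_half_add {ι : Type*} {f g h : ι → ℂ} {s t : ℂ} (hf : HasSum f s)
    (hg : HasSum g t) (hh : ∀ i, h i = 1 / 2 * (f i + g i)) : HasSum h (1 / 2 * (s + t)) := by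
  rw [funext hh]
  exact (hf.add hg).mul_left (1 / 2)

theorem indicator_even_eq (l : List (ℤ × ℕ)) :
    Set.indicator {L | MG02 L ∧ Even L.length} (wordWeight (letterWeight q c0 c1 c2)) l =
      1 / 2 * (Set.indicator {L | MG02 L} (wordWeight (letterWeight q c0 c1 c2)) l +
        Set.indicator {L | MG02 L} (wordWeight (letterWeight q (-c0) (-c1) (-c2))) l) := by
  by_cases hl : MG02 l
  · rw [Set.indicator_of_mem (s := {L | MG02 L}) hl, Set.indicator_of_mem (s := {L | MG02 L}) hl,
      wordWeight_letterWeight_neg]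
    by_cases he : Even l.length
    · rw [Set.indicator_of_mem (show l ∈ {L | MG02 L ∧ Even L.length} from ⟨hl, he⟩),
        he.neg_one_pow]
      ring
    · rw [Set.indicator_of_notMem fun h : l ∈ {L | MG02 L ∧ Even L.length} => he h.2,
        (Nat.not_even_iff_odd.1 he).neg_one_pow]
      ring
  · rw [Set.indicator_of_notMem (s := {L | MG02 L}) hl,
      Set.indicator_of_notMem (s := {L | MG02 L}) hl,
      Set.indicator_of_notMem fun h : l ∈ {L | MG02 L ∧ Even L.length} => hl h.1]
    simp

end Weights

/-- The generating function of multi-grounded partitions in `²𝒫^≫_{c_0 c_2}` with an even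
total number of parts:
`∑_π C(π) q^{|π|} = (c_0 c_2 / (c_0 c_2 q⁴; q⁴)_∞) · ½ ·
  [ (−c_0 q³; q²)_∞ (−c_2 q⁻¹; q²)_∞ / (c_1 q; q²)_∞
    + (c_0 q³; q²)_∞ (c_2 q⁻¹; q²)_∞ / (−c_1 q; q²)_∞ ]`. -/
theorem mg02EvenGenFun (q c0 c1 c2 : ℂ) (hq0 : 0 < ‖q‖) (hq : ‖q‖ < 1)
    (h0 : ‖c0‖ ≤ 1) (h1 : ‖c1‖ ≤ 1) (h2 : ‖c2‖ ≤ 1) :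
    genFun (fun L => MG02 L ∧ Even L.length) q c0 c1 c2 =
      c0 * c2 / qPoch (c0 * c2 * q ^ 4) (q ^ 4) * (1 / 2) *
        (qPoch (-c0 * q ^ 3) (q ^ 2) * qPoch (-c2 * q⁻¹) (q ^ 2) / qPoch (c1 * q) (q ^ 2) +
          qPoch (c0 * q ^ 3) (q ^ 2) * qPoch (c2 * q⁻¹) (q ^ 2) / qPoch (-c1 * q) (q ^ 2)) := by

  have hpos := hasSum_mg02 hq0 hq h0 h1 h2
  have hneg := hasSum_mg02 (c0 := -c0) (c1 := -c1) (c2 := -c2) hq0 hq (by simpa) (by simpa)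
    (by simpa)
  have heven := hasSum_half_add hpos hneg indicator_even_eq
  have hsum : ∑' l : {L // MG02 L ∧ Even L.length}, wordWeight (letterWeight q c0 c1 c2) l = _ :=
    (hasSum_subtype_iff_indicator.2 heven).tsum_eq
  unfold genFun
  refine Eq.trans (tsum_congr fun L => ?_) (hsum.trans ?_)
  · exact (wordWeight_letterWeight_eq (norm_pos_iff.1 hq0) L.2.1.1).symm
  · simp only [neg_neg, neg_mul_neg]
    ring
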